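/- arXiv:1907.01998 — 4 statements merged into one kernel-verified Lean document; each statement's English description precedes it below -/
import Mathlib

section
/- The function ζ ↦ k0(ζ) is strictly decreasing on the interval [0, 4β - 2α]; moreover k0(ζ) > E2 for all ζ ∈ [0, 4β - 2α) and k0(4β - 2α) = E2. -/
open Set

/-- The critical point `k0(ζ)`. -/
noncomputable def kzero (α β ζ : ℝ) : ℝ :=
  -(4 * β + ζ) / 8 + Real.sqrt (α ^ 2 / 2 + ((4 * β - ζ) / 8) ^ 2)

/-- On `ζ ≤ 4β` both summands of `k0` decrease, the first one strictly. -/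
theorem kzero_strictAntiOn (α β : ℝ) : StrictAntiOn (kzero α β) (Set.Iic (4 * β)) := by
  intro x _ y hy hxy
  rw [Set.mem_Iic] at hy
  have hsqrt : Real.sqrt (α ^ 2 / 2 + ((4 * β - y) / 8) ^ 2) ≤
      Real.sqrt (α ^ 2 / 2 + ((4 * β - x) / 8) ^ 2) := by
    have hnonneg : 0 ≤ (4 * β - y) / 8 := by linarith
    gcongr
  unfold kzero
  linarith

theorem kzero_endpoint (α β : ℝ) (hα : 0 ≤ α) : kzero α β (4 * β - 2 * α) = -β + α := by
  have hsq : α ^ 2 / 2 + ((4 * β - (4 * β - 2 * α)) / 8) ^ 2 = (3 * α / 4) ^ 2 := by ring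
  rw [kzero, hsq, Real.sqrt_sq (by positivity)]
  ring

theorem stmt8 (α β : ℝ) (hα : 0 < α) (hαβ : α < 2 * β)
    (E2 : ℝ) (hE2 : E2 = -β + α) :
    StrictAntiOn (kzero α β) (Set.Icc 0 (4 * β - 2 * α)) ∧
    (∀ ζ ∈ Set.Ico (0 : ℝ) (4 * β - 2 * α), E2 < kzero α β ζ) ∧
    kzero α β (4 * β - 2 * α) = E2 := by
  have hend := kzero_endpoint α β hα.le
  have hanti : StrictAntiOn (kzero α β) (Set.Icc 0 (4 * β - 2 * α)) :=
    (kzero_strictAntiOn α β).mono fun ζ hζ => Set.mem_Iic.2 (by linarith [hζ.2])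
  refine ⟨hanti, fun ζ hζ => ?_, hend.trans hE2.symm⟩
  rw [hE2, ← hend]
  exact hanti ⟨hζ.1, hζ.2.le⟩ ⟨by linarith, le_rfl⟩ hζ.2
end

section
/- For each ζ with 0 ≤ ζ < 4β - 2α, the function s ↦ g(ζ, s) is real-valued on (-∞, E1] and on [E2, k0(ζ)], satisfies g(ζ, E1) = g(ζ, E2) = 0 and g(ζ, s) → +∞ as s → -∞, and is strictly decreasing on each of these two intervals; consequently it is a decreasing bijection from (-∞, E1) onto (0, ∞) and from (E2, k0(ζ)) onto (g(ζ, k0(ζ)), 0). -/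
open Complex Filter Set

/-- The branch `X(k) = (k - E1)^{1/2} (k - E2)^{1/2}` with principal square roots. -/
noncomputable def Xfun (E1 E2 : ℝ) (k : ℂ) : ℂ :=
  (k - (E1 : ℂ)) ^ ((1 : ℂ) / 2) * (k - (E2 : ℂ)) ^ ((1 : ℂ) / 2)

/-- The `g`-function `g(ζ, k) = (2k - 2β + ζ) X(k)`. -/
noncomputable def gfun (E1 E2 β ζ : ℝ) (k : ℂ) : ℂ :=
  (2 * k - 2 * (β : ℂ) + (ζ : ℂ)) * Xfun E1 E2 k

lemma cpow_half_of_nonneg {x : ℝ} (hx : 0 ≤ x) :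
    (x : ℂ) ^ ((1 : ℂ) / 2) = (Real.sqrt x : ℂ) := by
  rw [Real.sqrt_eq_rpow, Complex.ofReal_cpow hx]
  push_cast
  rfl

lemma cpow_half_of_nonpos {x : ℝ} (hx : x ≤ 0) :
    (x : ℂ) ^ ((1 : ℂ) / 2) = (Real.sqrt (-x) : ℂ) * Complex.I := by
  rw [Complex.ofReal_cpow_of_nonpos hx, ← Complex.ofReal_neg,
    cpow_half_of_nonneg (neg_nonneg.mpr hx)]
  congr 1
  rw [show (Real.pi : ℂ) * Complex.I * (1 / 2) = ((Real.pi / 2 : ℝ) : ℂ) * Complex.I by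
    push_cast; ring, Complex.exp_mul_I, ← Complex.ofReal_cos, ← Complex.ofReal_sin]
  simp

lemma gfun_of_le {E1 E2 s : ℝ} (β ζ : ℝ) (h1 : s ≤ E1) (h2 : s ≤ E2) :
    gfun E1 E2 β ζ (s : ℂ) =
      (((2 * β - ζ - 2 * s) * (Real.sqrt (E1 - s) * Real.sqrt (E2 - s)) : ℝ) : ℂ) := by
  rw [gfun, Xfun, ← Complex.ofReal_sub, ← Complex.ofReal_sub,
    cpow_half_of_nonpos (sub_nonpos.mpr h1), cpow_half_of_nonpos (sub_nonpos.mpr h2),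
    neg_sub, neg_sub]
  push_cast
  linear_combination (2 * (s : ℂ) - 2 * β + ζ) * Real.sqrt (E1 - s) * Real.sqrt (E2 - s) *
    Complex.I_sq

lemma gfun_of_ge {E1 E2 s : ℝ} (β ζ : ℝ) (h1 : E1 ≤ s) (h2 : E2 ≤ s) :
    gfun E1 E2 β ζ (s : ℂ) =
      (((2 * s - 2 * β + ζ) * Real.sqrt ((s - E1) * (s - E2)) : ℝ) : ℂ) := by
  rw [gfun, Xfun, ← Complex.ofReal_sub, ← Complex.ofReal_sub,
    cpow_half_of_nonneg (sub_nonneg.mpr h1), cpow_half_of_nonneg (sub_nonneg.mpr h2),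
    Real.sqrt_mul (sub_nonneg.mpr h1)]
  push_cast
  ring

lemma StrictAntiOn.bijOn_Ioo {f : ℝ → ℝ} {a b : ℝ} (hab : a ≤ b)
    (hf : StrictAntiOn f (Set.Icc a b)) (hc : ContinuousOn f (Set.Icc a b)) :
    Set.BijOn f (Set.Ioo a b) (Set.Ioo (f b) (f a)) :=
  ⟨fun _ hx => ⟨hf (Set.Ioo_subset_Icc_self hx) (Set.right_mem_Icc.mpr hab) hx.2,
    hf (Set.left_mem_Icc.mpr hab) (Set.Ioo_subset_Icc_self hx) hx.1⟩,
   hf.injOn.mono Set.Ioo_subset_Icc_self, intermediate_value_Ioo' hab hc⟩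

lemma StrictAntiOn.bijOn_Iio {f : ℝ → ℝ} {b : ℝ} (hf : StrictAntiOn f (Set.Iic b))
    (hc : ContinuousOn f (Set.Iic b)) (ht : Tendsto f atBot atTop) :
    Set.BijOn f (Set.Iio b) (Set.Ioi (f b)) := by
  refine ⟨fun x hx => hf (Set.Iio_subset_Iic_self hx) Set.self_mem_Iic hx,
    hf.injOn.mono Set.Iio_subset_Iic_self, fun y hy => ?_⟩
  obtain ⟨a, hya, hab⟩ := ((ht.eventually_gt_atTop y).and (eventually_le_atBot b)).exists
  obtain ⟨x, hx, rfl⟩ := intermediate_value_Ioo' hab (hc.mono Set.Icc_subset_Iic_self)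
    (show y ∈ Set.Ioo (f b) (f a) from ⟨hy, hya⟩)
  exact ⟨x, hx.2, rfl⟩

lemma strictAntiOn_left_branch {E1 E2 β ζ : ℝ} (h12 : E1 < E2) (hpos : 0 < 2 * β - ζ - 2 * E1) :
    StrictAntiOn (fun s => (2 * β - ζ - 2 * s) * (Real.sqrt (E1 - s) * Real.sqrt (E2 - s)))
      (Set.Iic E1) := by
  intro x hx y hy hxy
  simp only [Set.mem_Iic] at hx hy
  have hsqrt1 : Real.sqrt (E1 - y) < Real.sqrt (E1 - x) :=
    Real.sqrt_lt_sqrt (by linarith) (by linarith)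
  have hsqrt2 : Real.sqrt (E2 - y) < Real.sqrt (E2 - x) :=
    Real.sqrt_lt_sqrt (by linarith) (by linarith)
  have hnonneg1 := Real.sqrt_nonneg (E1 - y)
  have hnonneg2 := Real.sqrt_nonneg (E2 - y)
  exact mul_lt_mul'' (by linarith) (mul_lt_mul'' hsqrt1 hsqrt2 hnonneg1 hnonneg2) (by linarith)
    (by positivity)

lemma tendsto_left_branch (E1 E2 β ζ : ℝ) :
    Tendsto (fun s => (2 * β - ζ - 2 * s) * (Real.sqrt (E1 - s) * Real.sqrt (E2 - s)))
      atBot atTop := by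
  have hsub (c : ℝ) : Tendsto (fun s : ℝ => c - s) atBot atTop :=
    tendsto_atTop_add_const_left _ c tendsto_neg_atBot_atTop
  have hlin : Tendsto (fun s : ℝ => 2 * β - ζ - 2 * s) atBot atTop :=
    tendsto_atTop_add_const_left _ (2 * β - ζ)
      (tendsto_neg_atBot_atTop.comp (tendsto_id.const_mul_atBot two_pos))
  exact hlin.atTop_mul_atTop₀ ((Real.tendsto_sqrt_atTop.comp (hsub E1)).atTop_mul_atTop₀
    (Real.tendsto_sqrt_atTop.comp (hsub E2)))

lemma lt_kzero {α β ζ : ℝ} (hα : 0 < α) (hζ : ζ < 4 * β - 2 * α) : -β + α < kzero α β ζ := by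
  have : α - (4 * β - ζ) / 8 < Real.sqrt (α ^ 2 / 2 + ((4 * β - ζ) / 8) ^ 2) :=
    Real.lt_sqrt_of_sq_lt (by nlinarith)
  rw [kzero]
  linarith

lemma quadratic_neg_of_lt_kzero {α β ζ s : ℝ} (hα : 0 < α)
    (hs : -β + α < s) (hs' : s < kzero α β ζ) :
    4 * (s + β) ^ 2 - (4 * β - ζ) * (s + β) - 2 * α ^ 2 < 0 := by
  have hrad : 0 ≤ α ^ 2 / 2 + ((4 * β - ζ) / 8) ^ 2 := by positivity
  have hsq := Real.sq_sqrt hrad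
  rw [kzero] at hs'
  set r := Real.sqrt (α ^ 2 / 2 + ((4 * β - ζ) / 8) ^ 2)
  have hr : (4 * β - ζ) / 8 < r := by
    refine Real.lt_sqrt_of_sq_lt ?_
    have := pow_pos hα 2
    linarith
  have hfac : (s + β - (4 * β - ζ) / 8 - r) * (s + β - (4 * β - ζ) / 8 + r) < 0 :=
    mul_neg_of_neg_of_pos (by linarith) (by linarith)
  nlinarith

lemma strictAntiOn_right_branch {α : ℝ} (β ζ : ℝ) (hα : 0 < α) :
    StrictAntiOn
      (fun s => (2 * s - 2 * β + ζ) * Real.sqrt ((s - (-β - α)) * (s - (-β + α))))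
      (Set.Icc (-β + α) (kzero α β ζ)) := by
  refine strictAntiOn_of_deriv_neg (convex_Icc _ _) (by fun_prop) fun s hs => ?_
  rw [interior_Icc] at hs
  have hpos : 0 < (s - (-β - α)) * (s - (-β + α)) :=
    mul_pos (by linarith [hs.1]) (by linarith [hs.1])
  have hlin : HasDerivAt (fun s : ℝ => 2 * s - 2 * β + ζ) 2 s := by
    simpa using (((hasDerivAt_id s).const_mul 2).sub_const (2 * β)).add_const ζ
  have hprod := (((hasDerivAt_id s).sub_const (-β - α)).mul
    ((hasDerivAt_id s).sub_const (-β + α))).sqrt hpos.ne'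
  have hderiv := hlin.mul hprod
  have hsqrt := Real.sqrt_pos.mpr hpos
  have hsq := Real.sq_sqrt hpos.le
  refine lt_of_eq_of_lt hderiv.deriv ?_
  simp only [id, Pi.mul_apply]
  set r := Real.sqrt ((s - (-β - α)) * (s - (-β + α)))
  have hquad := quadratic_neg_of_lt_kzero hα hs.1 hs.2
  refine lt_of_eq_of_lt ?_ (div_neg_of_neg_of_pos hquad hsqrt)
  field_simp
  rw [hsq]
  ring

theorem stmt9 (α β : ℝ) (hα : 0 < α) (hαβ : α < 2 * β)
    (E1 E2 : ℝ) (hE1 : E1 = -β - α) (hE2 : E2 = -β + α)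
    (ζ : ℝ) (hζ : 0 ≤ ζ) (hζ' : ζ < 4 * β - 2 * α) :
    (∀ s : ℝ, s ≤ E1 → (gfun E1 E2 β ζ (s : ℂ)).im = 0) ∧
    (∀ s ∈ Set.Icc E2 (kzero α β ζ), (gfun E1 E2 β ζ (s : ℂ)).im = 0) ∧
    gfun E1 E2 β ζ (E1 : ℂ) = 0 ∧ gfun E1 E2 β ζ (E2 : ℂ) = 0 ∧
    Tendsto (fun s : ℝ => (gfun E1 E2 β ζ (s : ℂ)).re) atBot atTop ∧
    StrictAntiOn (fun s : ℝ => (gfun E1 E2 β ζ (s : ℂ)).re) (Set.Iic E1) ∧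
    StrictAntiOn (fun s : ℝ => (gfun E1 E2 β ζ (s : ℂ)).re) (Set.Icc E2 (kzero α β ζ)) ∧
    Set.BijOn (fun s : ℝ => (gfun E1 E2 β ζ (s : ℂ)).re) (Set.Iio E1) (Set.Ioi 0) ∧
    Set.BijOn (fun s : ℝ => (gfun E1 E2 β ζ (s : ℂ)).re) (Set.Ioo E2 (kzero α β ζ))
      (Set.Ioo ((gfun E1 E2 β ζ ((kzero α β ζ : ℝ) : ℂ)).re) 0) := by
  subst hE1 hE2
  have hlt : -β - α < -β + α := by linarith
  have hk := lt_kzero hα hζ'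
  have hleft (s : ℝ) (hs : s ≤ -β - α) := gfun_of_le β ζ hs (hs.trans hlt.le)
  have hright (s : ℝ) (hs : -β + α ≤ s) := gfun_of_ge β ζ (hlt.le.trans hs) hs
  have hzero1 : gfun (-β - α) (-β + α) β ζ ((-β - α : ℝ) : ℂ) = 0 := by
    rw [hleft _ le_rfl]
    simp
  have hzero2 : gfun (-β - α) (-β + α) β ζ ((-β + α : ℝ) : ℂ) = 0 := by
    rw [hright _ le_rfl]
    simp
  have hre_left : Set.EqOn
      (fun s => (2 * β - ζ - 2 * s) * (Real.sqrt (-β - α - s) * Real.sqrt (-β + α - s)))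
      (fun s : ℝ => (gfun (-β - α) (-β + α) β ζ (s : ℂ)).re) (Set.Iic (-β - α)) := by
    intro s hs
    simp only [hleft s hs, Complex.ofReal_re]
  have hre_right : Set.EqOn
      (fun s => (2 * s - 2 * β + ζ) * Real.sqrt ((s - (-β - α)) * (s - (-β + α))))
      (fun s : ℝ => (gfun (-β - α) (-β + α) β ζ (s : ℂ)).re)
      (Set.Icc (-β + α) (kzero α β ζ)) := by
    intro s hs
    simp only [hright s hs.1, Complex.ofReal_re]
  have hanti_left := (strictAntiOn_left_branch hlt
    (show 0 < 2 * β - ζ - 2 * (-β - α) by linarith)).congr hre_left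
  have hanti_right := (strictAntiOn_right_branch β ζ hα).congr hre_right
  have htendsto := (tendsto_left_branch (-β - α) (-β + α) β ζ).congr'
    ((eventually_le_atBot (-β - α)).mono fun s hs => hre_left hs)
  have hcont_left := ContinuousOn.congr
    (show ContinuousOn _ (Set.Iic (-β - α)) by fun_prop) hre_left.symm
  have hcont_right := ContinuousOn.congr
    (show ContinuousOn _ (Set.Icc (-β + α) (kzero α β ζ)) by fun_prop) hre_right.symm
  refine ⟨fun s hs => ?_, fun s hs => ?_, hzero1, hzero2, htendsto, hanti_left, hanti_right,
    ?_, ?_⟩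
  · rw [hleft s hs, Complex.ofReal_im]
  · rw [hright s hs.1, Complex.ofReal_im]
  · simpa only [hzero1, Complex.zero_re] using hanti_left.bijOn_Iio hcont_left htendsto
  · simpa only [hzero2, Complex.zero_re] using hanti_right.bijOn_Ioo hk.le hcont_right
end

section
/- For each ζ with 0 ≤ ζ < 4β - 2α, the point k0(ζ) is a nondegenerate critical point of k ↦ g(ζ, k): the first derivative satisfies g'(ζ, k0(ζ)) = 0 and the second derivative satisfies g''(ζ, k0(ζ)) = 4 (k0(ζ) - k1(ζ)) / X(k0(ζ)) > 0. -/
open Complex Filter Set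

/-- The critical point `k1(ζ)`. -/
noncomputable def kone (α β ζ : ℝ) : ℝ :=
  -(4 * β + ζ) / 8 - Real.sqrt (α ^ 2 / 2 + ((4 * β - ζ) / 8) ^ 2)

lemma Xfun_ne_zero {E1 E2 : ℝ} {k : ℂ} (h1 : E1 < k.re) (h2 : E2 < k.re) :
    Xfun E1 E2 k ≠ 0 := by
  have hne : ∀ {E : ℝ}, E < k.re → k - (E : ℂ) ≠ 0 := fun h h0 => by
    have := congrArg Complex.re h0
    simp at this
    linarith
  simp [Xfun, Complex.cpow_eq_zero_iff, hne h1, hne h2]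

lemma Xfun_sq (E1 E2 : ℝ) (k : ℂ) : Xfun E1 E2 k ^ 2 = (k - E1) * (k - E2) := by
  have hsq : ∀ z : ℂ, (z ^ ((1 : ℂ) / 2)) ^ 2 = z := fun z => by
    simp
  rw [Xfun, mul_pow, hsq, hsq]

lemma Xfun_ofReal {E1 E2 x : ℝ} (h1 : E1 < x) (h2 : E2 < x) :
    Xfun E1 E2 x = ((x - E1) ^ ((1 : ℝ) / 2) * (x - E2) ^ ((1 : ℝ) / 2) : ℝ) := by
  rw [Xfun, Complex.ofReal_mul, Complex.ofReal_cpow (by linarith),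
    Complex.ofReal_cpow (by linarith)]
  push_cast
  rfl

lemma hasDerivAt_Xfun {E1 E2 : ℝ} {k : ℂ} (h1 : E1 < k.re) (h2 : E2 < k.re) :
    HasDerivAt (Xfun E1 E2) ((2 * k - E1 - E2) / (2 * Xfun E1 E2 k)) k := by
  have hslit : ∀ {E : ℝ}, E < k.re → k - (E : ℂ) ∈ Complex.slitPlane := fun h => by
    left
    simpa using h
  have hdiff : ∀ {E : ℝ}, E < k.re →
      DifferentiableAt ℂ (fun z : ℂ => (z - (E : ℂ)) ^ ((1 : ℂ) / 2)) k := fun h =>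
    (differentiableAt_id.sub_const _).cpow_const (hslit h)
  have hX : HasDerivAt (Xfun E1 E2) (deriv (Xfun E1 E2) k) k :=
    ((hdiff h1).mul (hdiff h2)).hasDerivAt
  have hsq : HasDerivAt (fun z => Xfun E1 E2 z ^ 2) (2 * k - E1 - E2) k := by
    simp only [Xfun_sq]
    refine (((hasDerivAt_id k).sub_const (E1 : ℂ)).mul
      ((hasDerivAt_id k).sub_const (E2 : ℂ))).congr_deriv ?_
    simp only [id_eq]
    ring
  have heq := (hX.pow 2).unique hsq
  convert hX using 1
  rw [div_eq_iff (mul_ne_zero two_ne_zero (Xfun_ne_zero h1 h2)), ← heq]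
  push_cast
  ring

lemma kzero_add_kone (α β ζ : ℝ) : kzero α β ζ + kone α β ζ = -(4 * β + ζ) / 4 := by
  rw [kzero, kone]
  ring

lemma kzero_mul_kone (α β ζ : ℝ) :
    kzero α β ζ * kone α β ζ = (β * ζ - 2 * α ^ 2) / 4 := by
  have h := Real.sq_sqrt (show 0 ≤ α ^ 2 / 2 + ((4 * β - ζ) / 8) ^ 2 by positivity)
  rw [kzero, kone]
  linear_combination -h

lemma kone_lt_kzero {α : ℝ} (hα : 0 < α) (β ζ : ℝ) : kone α β ζ < kzero α β ζ := by
  have h : 0 < Real.sqrt (α ^ 2 / 2 + ((4 * β - ζ) / 8) ^ 2) := Real.sqrt_pos.2 (by positivity)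
  rw [kzero, kone]
  linarith

lemma deriv_gfun {α β ζ : ℝ} {k : ℂ} (h1 : -β - α < k.re) (h2 : -β + α < k.re) :
    deriv (gfun (-β - α) (-β + α) β ζ) k =
      (k - kzero α β ζ) * (4 * (k - kone α β ζ) / Xfun (-β - α) (-β + α) k) := by
  have hX := Xfun_ne_zero h1 h2
  have hsq := Xfun_sq (-β - α) (-β + α) k
  have hlin : HasDerivAt (fun z : ℂ => 2 * z - 2 * (β : ℂ) + (ζ : ℂ)) 2 k := by
    simpa using (((hasDerivAt_id k).const_mul 2).sub_const (2 * (β : ℂ))).add_const (ζ : ℂ)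
  have hadd : (kzero α β ζ : ℂ) + kone α β ζ = -(4 * β + ζ) / 4 := by
    exact_mod_cast kzero_add_kone α β ζ
  have hmul : (kzero α β ζ : ℂ) * kone α β ζ = (β * ζ - 2 * α ^ 2) / 4 := by
    exact_mod_cast kzero_mul_kone α β ζ
  refine (hlin.mul (hasDerivAt_Xfun h1 h2)).deriv.trans ?_
  push_cast at hsq ⊢
  field_simp
  linear_combination 4 * hsq + 8 * k * hadd - 8 * hmul

theorem stmt10 (α β : ℝ) (hα : 0 < α) (hαβ : α < 2 * β)
    (E1 E2 : ℝ) (hE1 : E1 = -β - α) (hE2 : E2 = -β + α)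
    (ζ : ℝ) (hζ : 0 ≤ ζ) (hζ' : ζ < 4 * β - 2 * α) :
    deriv (gfun E1 E2 β ζ) ((kzero α β ζ : ℝ) : ℂ) = 0 ∧
    deriv (deriv (gfun E1 E2 β ζ)) ((kzero α β ζ : ℝ) : ℂ)
      = 4 * ((kzero α β ζ : ℂ) - (kone α β ζ : ℂ)) / Xfun E1 E2 (kzero α β ζ : ℂ) ∧
    ∃ c : ℝ, 0 < c ∧
      4 * ((kzero α β ζ : ℂ) - (kone α β ζ : ℂ)) / Xfun E1 E2 (kzero α β ζ : ℂ) = (c : ℂ) := by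
  subst hE1 hE2
  have h2 : -β + α < kzero α β ζ := lt_kzero hα hζ'
  have h1 : -β - α < kzero α β ζ := by linarith
  refine ⟨?_, ?_, ?_⟩
  · rw [deriv_gfun (by simpa using h1) (by simpa using h2), sub_self, zero_mul]
  · have hev : deriv (gfun (-β - α) (-β + α) β ζ) =ᶠ[nhds (kzero α β ζ : ℂ)] fun k =>
        (k - kzero α β ζ) * (4 * (k - kone α β ζ) / Xfun (-β - α) (-β + α) k) := by
      filter_upwards [(isOpen_lt continuous_const Complex.continuous_re).mem_nhds
        (show -β + α < (kzero α β ζ : ℂ).re by simpa using h2)] with k hk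
      have hk' : -β + α < k.re := hk
      exact deriv_gfun (by linarith) hk'
    have hdiff : DifferentiableAt ℂ
        (fun k : ℂ => 4 * (k - kone α β ζ) / Xfun (-β - α) (-β + α) k) (kzero α β ζ : ℂ) :=
      ((differentiableAt_id.sub_const _).const_mul 4).div
        (hasDerivAt_Xfun (by simpa using h1) (by simpa using h2)).differentiableAt
        (Xfun_ne_zero (by simpa using h1) (by simpa using h2))
    rw [hev.deriv_eq]
    refine (((hasDerivAt_id (kzero α β ζ : ℂ)).sub_const (kzero α β ζ : ℂ)).mul
      hdiff.hasDerivAt).deriv.trans ?_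
    simp
  · have hpos1 := Real.rpow_pos_of_pos (sub_pos.2 h1) (1 / 2)
    have hpos2 := Real.rpow_pos_of_pos (sub_pos.2 h2) (1 / 2)
    have hk := sub_pos.2 (kone_lt_kzero hα β ζ)
    refine ⟨_, div_pos (mul_pos four_pos hk) (mul_pos hpos1 hpos2), ?_⟩
    rw [Xfun_ofReal h1 h2]
    push_cast
    rfl
end

section
/- The matrix m^{(∞)}(k) = (1/2)[[Δ(k) + Δ(k)^{-1}, -i(Δ(k) - Δ(k)^{-1})], [i(Δ(k) - Δ(k)^{-1}), Δ(k) + Δ(k)^{-1}]] satisfies the asymptotic expansion m^{(∞)}(k) = I + (1/k)[[0, iα/2], [-iα/2, 0]] + (1/k²)[[α²/8, -iαβ/2], [iαβ/2, α²/8]] + O(k^{-3}) as k → ∞; in particular lim_{k→∞} k (m^{(∞)}(k) - I) = [[0, iα/2], [-iα/2, 0]] and lim_{k→∞} k² (m^{(∞)}(k) - I - (1/k)[[0, iα/2], [-iα/2, 0]]) = [[α²/8, -iαβ/2], [iαβ/2, α²/8]]. -/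
open Complex Filter Set Matrix Asymptotics Bornology Topology

/-- The function `Δ(k) = ((k - E2)/(k - E1))^{1/4}` with the principal fourth root. -/
noncomputable def Dlt (E1 E2 : ℝ) (k : ℂ) : ℂ :=
  ((k - (E2 : ℂ)) / (k - (E1 : ℂ))) ^ ((1 : ℂ) / 4)

/-- The global parametrix `m^{(∞)}(k)`. -/
noncomputable def minf (E1 E2 : ℝ) (k : ℂ) : Matrix (Fin 2) (Fin 2) ℂ :=
  (1 / 2 : ℂ) •
    !![Dlt E1 E2 k + (Dlt E1 E2 k)⁻¹, -I * (Dlt E1 E2 k - (Dlt E1 E2 k)⁻¹);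
       I * (Dlt E1 E2 k - (Dlt E1 E2 k)⁻¹), Dlt E1 E2 k + (Dlt E1 E2 k)⁻¹]

/-- Second-order expansion, as `z → 0`, of a fourth root tending to `1` of `(1 - b z) / (1 - a z)`. -/
theorem fourth_root_expansion {ι : Type*} {l : Filter ι} {z D : ι → ℂ} (a b : ℂ)
    (hz : Tendsto z l (𝓝 0)) (hD : Tendsto D l (𝓝 1))
    (h : ∀ᶠ x in l, D x ^ 4 * (1 - a * z x) = 1 - b * z x) :
    (fun x => D x - (1 + (a - b) / 4 * z x
      + ((a ^ 2 - b ^ 2) / 8 + (a - b) ^ 2 / 32) * z x ^ 2)) =O[l] fun x => z x ^ 3 := by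
  obtain ⟨p, hp⟩ : ∃ p, p = (a - b) / 4 := ⟨_, rfl⟩
  obtain ⟨q, hq⟩ : ∃ q, q = (a ^ 2 - b ^ 2) / 8 + (a - b) ^ 2 / 32 := ⟨_, rfl⟩
  rw [← hp, ← hq]
  let P : ℂ → ℂ := fun w => 1 + p * w + q * w ^ 2
  let T : ℂ → ℂ := fun w => (4 * p ^ 3 + 12 * p * q) + (p ^ 4 + 12 * p ^ 2 * q + 6 * q ^ 2) * w
    + (4 * p ^ 3 * q + 12 * p * q ^ 2) * w ^ 2 + (6 * p ^ 2 * q ^ 2 + 4 * q ^ 3) * w ^ 3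
    + 4 * p * q ^ 3 * w ^ 4 + q ^ 4 * w ^ 5
  let R : ℂ → ℂ := fun w => a * (4 * q + 6 * p ^ 2 + w * T w) - T w
  let S : ι → ℂ := fun x =>
    (D x ^ 3 + D x ^ 2 * P (z x) + D x * P (z x) ^ 2 + P (z x) ^ 3) * (1 - a * z x)
  have hP : Tendsto (fun x => P (z x)) l (𝓝 1) := by
    have hc : Continuous P := by fun_prop
    simpa [P, Function.comp_def] using (hc.tendsto 0).comp hz
  have hR : Tendsto (fun x => R (z x)) l (𝓝 (R 0)) := by
    have hc : Continuous R := by fun_prop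
    exact (hc.tendsto 0).comp hz
  have hS : Tendsto S l (𝓝 4) := by
    have := ((((hD.pow 3).add ((hD.pow 2).mul hP)).add (hD.mul (hP.pow 2))).add (hP.pow 3)).mul
      ((hz.const_mul a).const_sub 1)
    convert this using 2
    norm_num
  have hO : (fun x => R (z x) / S x) =O[l] fun _ => (1 : ℂ) :=
    (hR.div hS (by norm_num)).isBigO_one ℂ
  have hmul := hO.mul (isBigO_refl (fun x => z x ^ 3) l)
  simp only [one_mul] at hmul
  refine hmul.congr' ?_ EventuallyEq.rfl
  filter_upwards [h, hS.eventually_ne (by norm_num : (4 : ℂ) ≠ 0)] with x hx hSx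
  rw [div_mul_eq_mul_div, div_eq_iff hSx]
  simp only [R, S, T, P]
  have hb : b = a - 4 * p := by rw [hp]; ring
  have hq' : 4 * q + 6 * p ^ 2 = 4 * p * a := by rw [hp, hq]; ring
  rw [hb] at hx
  linear_combination -hx + (z x ^ 2) * hq'

theorem tendsto_sub_div_sub_cobounded (a b : ℂ) :
    Tendsto (fun k : ℂ => (k - b) / (k - a)) (cobounded ℂ) (𝓝 1) := by
  have hz : Tendsto (fun k : ℂ => k⁻¹) (cobounded ℂ) (𝓝 0) := tendsto_inv₀_cobounded
  have h := ((hz.const_mul b).const_sub 1).div ((hz.const_mul a).const_sub 1) (by simp)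
  simp only [mul_zero, sub_zero, div_one] at h
  refine h.congr' ?_
  filter_upwards [eventually_ne_cobounded (0 : ℂ)] with k hk
  rw [Pi.div_apply, ← mul_div_mul_left _ _ hk]
  congr 1 <;> field_simp

theorem tendsto_Dlt_cobounded (E1 E2 : ℝ) : Tendsto (Dlt E1 E2) (cobounded ℂ) (𝓝 1) := by
  have h := (tendsto_sub_div_sub_cobounded (E1 : ℂ) E2).cpow
    (tendsto_const_nhds (x := (1 : ℂ) / 4)) (by simp)
  rw [one_cpow] at h
  exact h

theorem Dlt_pow_four (E1 E2 : ℝ) (k : ℂ) :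
    Dlt E1 E2 k ^ 4 = (k - (E2 : ℂ)) / (k - (E1 : ℂ)) := by
  rw [Dlt, ← Complex.cpow_nat_mul]
  norm_num

theorem Dlt_expansion (E1 E2 : ℝ) :
    (fun k => Dlt E1 E2 k - (1 + ((E1 : ℂ) - E2) / 4 * k⁻¹
      + (((E1 : ℂ) ^ 2 - (E2 : ℂ) ^ 2) / 8 + ((E1 : ℂ) - E2) ^ 2 / 32) * k⁻¹ ^ 2))
      =O[cobounded ℂ] fun k => k⁻¹ ^ 3 := by
  refine fourth_root_expansion _ _ tendsto_inv₀_cobounded (tendsto_Dlt_cobounded E1 E2) ?_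
  filter_upwards [eventually_ne_cobounded (0 : ℂ), eventually_ne_cobounded (E1 : ℂ)] with k hk hk1
  have := sub_ne_zero.2 hk1
  rw [Dlt_pow_four]
  field_simp

theorem Dlt_inv_expansion (E1 E2 : ℝ) :
    (fun k => (Dlt E1 E2 k)⁻¹ - (1 + ((E2 : ℂ) - E1) / 4 * k⁻¹
      + (((E2 : ℂ) ^ 2 - (E1 : ℂ) ^ 2) / 8 + ((E2 : ℂ) - E1) ^ 2 / 32) * k⁻¹ ^ 2))
      =O[cobounded ℂ] fun k => k⁻¹ ^ 3 := by
  refine fourth_root_expansion _ _ tendsto_inv₀_cobounded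
    (by simpa using (tendsto_Dlt_cobounded E1 E2).inv₀ one_ne_zero) ?_
  filter_upwards [eventually_ne_cobounded (0 : ℂ), eventually_ne_cobounded (E2 : ℂ)] with k hk hk2
  have := sub_ne_zero.2 hk2
  rw [inv_pow, Dlt_pow_four, inv_div]
  field_simp

/-- A second-order expansion at infinity determines the limits defining its coefficients. -/
theorem tendsto_of_expansion_cobounded {f : ℂ → ℂ} {a b : ℂ}
    (h : (fun k => f k - k⁻¹ * a - (k ^ 2)⁻¹ * b) =O[cobounded ℂ] fun k => (k ^ 3)⁻¹) :
    Tendsto (fun k => k * f k) (cobounded ℂ) (𝓝 a) ∧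
      Tendsto (fun k => k ^ 2 * (f k - k⁻¹ * a)) (cobounded ℂ) (𝓝 b) := by
  have hz : Tendsto (fun k : ℂ => k⁻¹) (cobounded ℂ) (𝓝 0) := tendsto_inv₀_cobounded
  have hO : (fun k => k ^ 2 * (f k - k⁻¹ * a - (k ^ 2)⁻¹ * b)) =O[cobounded ℂ]
      fun k => k⁻¹ := by
    refine ((isBigO_refl (fun k : ℂ => k ^ 2) _).mul h).congr' EventuallyEq.rfl ?_
    filter_upwards [eventually_ne_cobounded (0 : ℂ)] with k hk
    field_simp
  have hb : Tendsto (fun k => k ^ 2 * (f k - k⁻¹ * a)) (cobounded ℂ) (𝓝 b) := by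
    have := (hO.trans_tendsto hz).add_const b
    rw [zero_add] at this
    refine this.congr' ?_
    filter_upwards [eventually_ne_cobounded (0 : ℂ)] with k hk
    field_simp
    ring
  refine ⟨?_, hb⟩
  have := (hz.mul hb).add_const a
  rw [zero_mul, zero_add] at this
  refine this.congr' ?_
  filter_upwards [eventually_ne_cobounded (0 : ℂ)] with k hk
  field_simp
  ring

theorem stmt17 (α β : ℝ) (hα : 0 < α) (hαβ : α < 2 * β)
    (E1 E2 : ℝ) (hE1 : E1 = -β - α) (hE2 : E2 = -β + α)
    (A1 A2 : Matrix (Fin 2) (Fin 2) ℂ)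
    (hA1 : A1 = !![0, I * (α : ℂ) / 2; -(I * (α : ℂ) / 2), 0])
    (hA2 : A2 = !![(α : ℂ) ^ 2 / 8, -(I * (α : ℂ) * (β : ℂ) / 2);
                   I * (α : ℂ) * (β : ℂ) / 2, (α : ℂ) ^ 2 / 8]) :
    (∀ i j : Fin 2,
      (fun k : ℂ => (minf E1 E2 k - 1 - k⁻¹ • A1 - (k ^ 2)⁻¹ • A2) i j)
        =O[cobounded ℂ] (fun k : ℂ => (k ^ 3)⁻¹)) ∧
    Tendsto (fun k : ℂ => k • (minf E1 E2 k - 1)) (cobounded ℂ) (𝓝 A1) ∧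
    Tendsto (fun k : ℂ => (k ^ 2) • (minf E1 E2 k - 1 - k⁻¹ • A1)) (cobounded ℂ) (𝓝 A2) := by
  have main : ∀ i j : Fin 2,
      (fun k : ℂ => (minf E1 E2 k - 1 - k⁻¹ • A1 - (k ^ 2)⁻¹ • A2) i j)
        =O[cobounded ℂ] (fun k : ℂ => (k ^ 3)⁻¹) := by
    have hD := Dlt_expansion E1 E2
    have hI := Dlt_inv_expansion E1 E2
    have h1 : (E1 : ℂ) = -β - α := by rw [hE1]; push_cast; ring
    have h2 : (E2 : ℂ) = -β + α := by rw [hE2]; push_cast; ring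
    rw [h1, h2] at hD hI
    have hadd := (hD.add hI).const_mul_left (1 / 2)
    have hsub := (hD.sub hI).const_mul_left (I / 2)
    intro i j
    simp only [← inv_pow]
    fin_cases i <;> fin_cases j
    · refine hadd.congr_left fun k => ?_
      simp [minf, hA1, hA2]
      ring
    · refine hsub.neg_left.congr_left fun k => ?_
      simp [minf, hA1, hA2]
      ring
    · refine hsub.congr_left fun k => ?_
      simp [minf, hA1, hA2]
      ring
    · refine hadd.congr_left fun k => ?_
      simp [minf, hA1, hA2]
      ring
  have hlim := fun i j => tendsto_of_expansion_cobounded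
    (f := fun k => (minf E1 E2 k - 1) i j) (main i j)
  exact ⟨main, tendsto_pi_nhds.2 fun i => tendsto_pi_nhds.2 fun j => (hlim i j).1,
    tendsto_pi_nhds.2 fun i => tendsto_pi_nhds.2 fun j => (hlim i j).2⟩
end
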